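/- arXiv:2104.14083 — 2 statements merged into one kernel-verified Lean document; each statement's English description precedes it below -/
import Mathlib

section
/- Let R = ℝ[ϖ_1,…,ϖ_n]/(α_i ϖ_i : 1 ≤ i ≤ n) with type C_n relations α_i = -ϖ_{i-1} + 2ϖ_i - ϖ_{i+1} for 1 ≤ i ≤ n-1, α_n = -2ϖ_{n-1} + 2ϖ_n, and ϖ_0 = 0. Then for all 1 ≤ a ≤ i ≤ n: ϖ_i · (ϖ_a ϖ_{a+1} ⋯ ϖ_n) = ϖ_{a-1} ϖ_a ⋯ ϖ_n. -/
open MvPolynomial Finset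

theorem stmt_6 (n : ℕ) (hn : 2 ≤ n)
    (ϖ : ℕ → MvPolynomial ℕ ℝ)
    (hϖ : ∀ k, ϖ k = if 1 ≤ k ∧ k ≤ n then X k else 0)
    (α : ℕ → MvPolynomial ℕ ℝ)
    (hα1 : ∀ k, 1 ≤ k → k ≤ n - 1 → α k = -ϖ (k - 1) + 2 * ϖ k - ϖ (k + 1))
    (hα2 : α n = -2 * ϖ (n - 1) + 2 * ϖ n)
    (I : Ideal (MvPolynomial ℕ ℝ))
    (hI : I = Ideal.span {p | ∃ k, 1 ≤ k ∧ k ≤ n ∧ p = α k * ϖ k})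
    (a i : ℕ) (ha : 1 ≤ a) (hai : a ≤ i) (hin : i ≤ n) :
    Ideal.Quotient.mk I (ϖ i * ∏ k ∈ Finset.Icc a n, ϖ k) =
      Ideal.Quotient.mk I (∏ k ∈ Finset.Icc (a - 1) n, ϖ k) := by
  have hrel : ∀ k, a ≤ k → k ≤ n → α k * ∏ j ∈ Finset.Icc a n, ϖ j ∈ I := by
    intro k hk1 hk2
    have hmem : α k * ϖ k ∈ I := by
      rw [hI]
      exact Ideal.subset_span ⟨k, by omega, hk2, rfl⟩
    rw [← Finset.mul_prod_erase _ ϖ (Finset.mem_Icc.mpr ⟨hk1, hk2⟩), ← mul_assoc]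
    exact I.mul_mem_right _ hmem
  have hprod : ∏ k ∈ Finset.Icc (a - 1) n, ϖ k = ϖ (a - 1) * ∏ j ∈ Finset.Icc a n, ϖ j := by
    rw [← Finset.mul_prod_Ioc_eq_prod_Icc (by omega : a - 1 ≤ n)]
    congr 2
    ext x
    simp only [Finset.mem_Ioc, Finset.mem_Icc]
    omega
  rw [hprod]
  generalize (∏ j ∈ Finset.Icc a n, ϖ j) = P at hrel ⊢
  have hd : ∀ m k, k + m = n → a ≤ k → (ϖ k - ϖ (k - 1)) * P ∈ I := by
    intro m
    induction m with
    | zero =>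
      intro k hk hak
      obtain rfl : k = n := by omega
      have h := I.mul_mem_left (C (1 / 2 : ℝ)) (hrel k hak le_rfl)
      rw [hα2] at h
      have h2 : (C (1 / 2 : ℝ) : MvPolynomial ℕ ℝ) * 2 = 1 := by
        rw [show (2 : MvPolynomial ℕ ℝ) = C (2 : ℝ) from (map_ofNat C 2).symm, ← C_mul]
        norm_num
      convert h using 1
      linear_combination (-(ϖ k - ϖ (k - 1)) * P) * h2
    | succ m ih =>
      intro k hk hak
      have h1 := ih (k + 1) (by omega) (by omega)
      have h := hrel k hak (by omega)
      rw [hα1 k (by omega) (by omega)] at h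
      rw [Nat.add_sub_cancel] at h1
      convert I.add_mem h h1 using 1
      ring
  rw [Ideal.Quotient.eq]
  induction i, hai using Nat.le_induction with
  | base => simpa [sub_mul] using hd (n - a) a (by omega) le_rfl
  | succ i hai ih =>
    have h := hd (n - (i + 1)) (i + 1) (by omega) (by omega)
    rw [Nat.add_sub_cancel] at h
    convert I.add_mem h (ih (by omega)) using 1
    ring
end

section
/- Let R = ℝ[ϖ_1,ϖ_2,ϖ_3,ϖ_4]/I where I is generated by ϖ_1·(2ϖ_1 - ϖ_2), ϖ_2·(-ϖ_1 + 2ϖ_2 - 2ϖ_3), ϖ_3·(-ϖ_2 + 2ϖ_3 - ϖ_4), and ϖ_4·(-ϖ_3 + 2ϖ_4). Then in R: ϖ_2·(ϖ_2 ϖ_3 ϖ_4) = (3/2)·ϖ_1 ϖ_2 ϖ_3 ϖ_4, ϖ_3·(ϖ_2 ϖ_3 ϖ_4) = ϖ_1 ϖ_2 ϖ_3 ϖ_4, and ϖ_4·(ϖ_2 ϖ_3 ϖ_4) = (1/2)·ϖ_1 ϖ_2 ϖ_3 ϖ_4. -/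
open MvPolynomial

theorem stmt_11 (I : Ideal (MvPolynomial ℕ ℝ))
    (hI : I = Ideal.span
      {X 1 * (2 * X 1 - X 2),
       X 2 * (-X 1 + 2 * X 2 - 2 * X 3),
       X 3 * (-X 2 + 2 * X 3 - X 4),
       X 4 * (-X 3 + 2 * X 4)}) :
    Ideal.Quotient.mk I (X 2 * (X 2 * X 3 * X 4)) =
        (3 / 2 : ℝ) • Ideal.Quotient.mk I (X 1 * X 2 * X 3 * X 4) ∧
    Ideal.Quotient.mk I (X 3 * (X 2 * X 3 * X 4)) =
        Ideal.Quotient.mk I (X 1 * X 2 * X 3 * X 4) ∧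
    Ideal.Quotient.mk I (X 4 * (X 2 * X 3 * X 4)) =
        (1 / 2 : ℝ) • Ideal.Quotient.mk I (X 1 * X 2 * X 3 * X 4) := by
  have h2 : (X 2 * (-X 1 + 2 * X 2 - 2 * X 3) : MvPolynomial ℕ ℝ) ∈ I := by
    rw [hI]; exact Ideal.subset_span (by simp)
  have h3 : (X 3 * (-X 2 + 2 * X 3 - X 4) : MvPolynomial ℕ ℝ) ∈ I := by
    rw [hI]; exact Ideal.subset_span (by simp)
  have h4 : (X 4 * (-X 3 + 2 * X 4) : MvPolynomial ℕ ℝ) ∈ I := by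
    rw [hI]; exact Ideal.subset_span (by simp)
  have hs : ∀ (r : ℝ) (p : MvPolynomial ℕ ℝ),
      r • Ideal.Quotient.mk I p = Ideal.Quotient.mk I (C r * p) := by
    intro r p
    rw [← smul_eq_C_mul]
    rfl
  have hh : (2 : MvPolynomial ℕ ℝ) * C (1 / 2 : ℝ) = 1 := by
    rw [← map_ofNat (C : ℝ →+* MvPolynomial ℕ ℝ) 2, ← C_mul, ← C_1]
    norm_num
  have h32 : (C (3 / 2 : ℝ) : MvPolynomial ℕ ℝ) = 3 * C (1 / 2 : ℝ) := by
    rw [← map_ofNat (C : ℝ →+* MvPolynomial ℕ ℝ) 3, ← C_mul]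
    norm_num
  rw [hs, hs, h32]
  generalize (C (1 / 2 : ℝ) : MvPolynomial ℕ ℝ) = h at hh
  -- the three relations, each multiplied up to degree four
  have key : ∀ a b c : MvPolynomial ℕ ℝ,
      a * (X 2 * (-X 1 + 2 * X 2 - 2 * X 3)) + b * (X 3 * (-X 2 + 2 * X 3 - X 4))
        + c * (X 4 * (-X 3 + 2 * X 4)) ∈ I := fun a b c =>
    I.add_mem (I.add_mem (I.mul_mem_left a h2) (I.mul_mem_left b h3)) (I.mul_mem_left c h4)
  refine ⟨?_, ?_, ?_⟩ <;> rw [Ideal.Quotient.eq]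
  · convert key (3 * h * (X 3 * X 4)) (2 * (X 2 * X 4)) (X 2 * X 3) using 1
    linear_combination (-3 * X 2 * X 3 * X 4 * (X 2 - X 3)) * hh
  · convert key (X 3 * X 4) (2 * (X 2 * X 4)) (X 2 * X 3) using 1
    ring
  · convert key (h * (X 3 * X 4)) (X 2 * X 4) (X 2 * X 3) using 1
    linear_combination (-X 2 * X 3 * X 4 * (X 2 - X 3)) * hh
end
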